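/- Let C be a Hurwitz algebra over a field k of characteristic ≠ 2, S the associated para-Hurwitz algebra and J = H₃(C,*). The linear map Φ : g(S₁,S) → der J determined by Φ((d₀,d₁,d₂)) = D_{(d₀,d₁,d₂)} for (d₀,d₁,d₂) ∈ tri(S) — where D_{(d₀,d₁,d₂)} is the derivation of J with D_{(d₀,d₁,d₂)}(e_i) = 0 and D_{(d₀,d₁,d₂)}(ι_i(a)) = ι_i(d_i(a)) — and Φ(ι_i(a)) = D_i(a) for i = 0,1,2 and a ∈ S, is an isomorphism of Lie algebras. -/

import Mathlib

noncomputable section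

variable {k : Type*} [Field k] {C : Type*} [NonAssocRing C] [Module k C]
  [SMulCommClass k C C] [IsScalarTower k C C]

/-- The polar form of the norm of the Hurwitz algebra `C`. -/
def bp (q : QuadraticForm k C) (x y : C) : k := QuadraticMap.polar q x y

/-- The standard involution `x ↦ b(x,1)1 - x` of the Hurwitz algebra `C`. -/
def conj (q : QuadraticForm k C) (x : C) : C := bp q x 1 • (1 : C) - x

/-- The para-Hurwitz product `x • y = x̄ ȳ` on `C`. -/
def pmul (q : QuadraticForm k C) (x y : C) : C := conj q x * conj q y

/-- The underlying space of the Jordan algebra `J = H₃(C,*)`, identified with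
`k³ ⊕ S ⊕ S ⊕ S` via the diagonal coordinates and the maps `ι₀, ι₁, ι₂`. -/
abbrev Jtype (k C : Type*) := (Fin 3 → k) × (Fin 3 → C)

/-- The diagonal idempotents `e₀, e₁, e₂` of `J = H₃(C,*)`. -/
def ee (i : Fin 3) : Jtype k C := (Pi.single i 1, 0)

/-- The elements `ι_i(a)` of `J = H₃(C,*)`. -/
def iot (i : Fin 3) (a : C) : Jtype k C := (0, Pi.single i a)

/-- The Jordan product `x ∘ y = ½(xy + yx)` of `J = H₃(C,*)`, written in the
coordinates `J = k³ ⊕ S ⊕ S ⊕ S` (indices mod 3):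
`e_j ∘ e_j = e_j`, `e_j ∘ e_l = 0` for `j ≠ l`, `e_i ∘ ι_i(a) = 0`,
`e_{i+1} ∘ ι_i(a) = e_{i+2} ∘ ι_i(a) = ½ ι_i(a)`,
`ι_i(a) ∘ ι_{i+1}(b) = ι_{i+2}(a • b)`, and
`ι_i(a) ∘ ι_i(b) = 2 b(a,b) (e_{i+1} + e_{i+2})`. -/
def jmul (q : QuadraticForm k C) (x y : Jtype k C) : Jtype k C :=
  (fun j => x.1 j * y.1 j + 2 * bp q (x.2 (j+1)) (y.2 (j+1))
      + 2 * bp q (x.2 (j+2)) (y.2 (j+2)),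
   fun i => ((2:k)⁻¹ * (x.1 (i+1) + x.1 (i+2))) • y.2 i
      + ((2:k)⁻¹ * (y.1 (i+1) + y.1 (i+2))) • x.2 i
      + pmul q (x.2 (i+1)) (y.2 (i+2)) + pmul q (y.2 (i+1)) (x.2 (i+2)))

/-- Derivations of the Jordan algebra `J = H₃(C,*)`. -/
def IsDerivJ (q : QuadraticForm k C) (f : Jtype k C → Jtype k C) : Prop :=
  ∀ x y, f (jmul q x y) = jmul q (f x) y + jmul q x (f y)

/-- The submodule of `Fin 3 → C` of elements supported at the single index `i`. -/
def piComp (k C : Type*) [Field k] [AddCommGroup C] [Module k C] (i : Fin 3) :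
    Submodule k (Fin 3 → C) where
  carrier := {a | ∀ j, j ≠ i → a j = 0}
  add_mem' := by
    intro a b ha hb j hj
    simp [ha j hj, hb j hj]
  zero_mem' := by intro j hj; rfl
  smul_mem' := by
    intro c a ha j hj
    simp [ha j hj]

/-- The `ℤ₂ × ℤ₂`-grading of `J = H₃(C,*)`:
`J_{(0,0)} = k³`, `J_{(1,0)} = ι₀(S)`, `J_{(0,1)} = ι₁(S)`, `J_{(1,1)} = ι₂(S)`. -/
def Jgrade (k C : Type*) [Field k] [AddCommGroup C] [Module k C] :
    ZMod 2 × ZMod 2 → Submodule k (Jtype k C) := fun p =>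
  if p = (0,0) then (⊤ : Submodule k (Fin 3 → k)).prod (⊥ : Submodule k (Fin 3 → C))
  else if p = (1,0) then (⊥ : Submodule k (Fin 3 → k)).prod (piComp k C 0)
  else if p = (0,1) then (⊥ : Submodule k (Fin 3 → k)).prod (piComp k C 1)
  else (⊥ : Submodule k (Fin 3 → k)).prod (piComp k C 2)

end

noncomputable section

variable {k : Type*} [Field k] {C : Type*} [NonAssocRing C] [Module k C]
  [SMulCommClass k C C] [IsScalarTower k C C]

/-- `L_x`, the multiplication operator `y ↦ x ∘ y` on `J`. -/
def Lmul (q : QuadraticForm k C) (x : Jtype k C) : Jtype k C → Jtype k C :=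
  fun y => jmul q x y

/-- The commutator of two maps `J → J`. -/
def brkt (f g : Jtype k C → Jtype k C) : Jtype k C → Jtype k C :=
  fun y => f (g y) - g (f y)

/-- The inner derivation `D_i(a) = 2[L_{ι_i(a)}, L_{e_{i+1}}]` of `J`. -/
def Dfun (q : QuadraticForm k C) (i : Fin 3) (a : C) : Jtype k C → Jtype k C :=
  fun y => (2:k) • brkt (Lmul q (iot i a)) (Lmul q (ee (i+1))) y

/-- The degree of `ι_i(S)` in the `ℤ₂ × ℤ₂`-grading of `J`. -/
def gidx : Fin 3 → ZMod 2 × ZMod 2 := ![(1,0), (0,1), (1,1)]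

end

noncomputable section

variable {k : Type*} [Field k] {C : Type*} [NonAssocRing C] [Module k C]
  [SMulCommClass k C C] [IsScalarTower k C C]

/-- The standard involution as a linear map. -/
def conjL (q : QuadraticForm k C) : C →ₗ[k] C where
  toFun x := conj q x
  map_add' x y := by
    simp only [conj, bp, QuadraticMap.polar_add_left, add_smul]
    abel
  map_smul' c x := by
    simp only [conj, bp, QuadraticMap.polar_smul_left, RingHom.id_apply, smul_sub,
      mul_smul, smul_eq_mul]

/-- Left multiplication `l_x : y ↦ x • y` in the para-Hurwitz algebra. -/
def lmap (q : QuadraticForm k C) (a : C) : Module.End k C :=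
  (LinearMap.mulLeft k (conj q a)) ∘ₗ conjL q

/-- Right multiplication `r_x : y ↦ y • x` in the para-Hurwitz algebra. -/
def rmap (q : QuadraticForm k C) (a : C) : Module.End k C :=
  (LinearMap.mulRight k (conj q a)) ∘ₗ conjL q

/-- `σ_{x,y} : z ↦ b(x,z)y − b(y,z)x`. -/
def sigL (q : QuadraticForm k C) (a b : C) : Module.End k C where
  toFun x := bp q a x • b - bp q b x • a
  map_add' x y := by
    simp only [bp, QuadraticMap.polar_add_right, add_smul]
    abel
  map_smul' c x := by
    simp only [bp, QuadraticMap.polar_smul_right, RingHom.id_apply, smul_sub, mul_smul,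
      smul_eq_mul]

/-- The element `t_{x,y} = (σ_{x,y}, ½b(x,y)id − r_x l_y, ½b(x,y)id − l_x r_y)` of `tri(S)`. -/
def tq (q : QuadraticForm k C) (a b : C) : Fin 3 → Module.End k C :=
  ![sigL q a b,
    ((2:k)⁻¹ * bp q a b) • (1 : Module.End k C) - rmap q a * lmap q b,
    ((2:k)⁻¹ * bp q a b) • (1 : Module.End k C) - lmap q a * rmap q b]

/-- The cyclic shift `θ^i : (d₀,d₁,d₂) ↦ (d₂,d₀,d₁)` (applied `i` times). -/
def tshift (i : Fin 3) (d : Fin 3 → Module.End k C) : Fin 3 → Module.End k C :=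
  fun j => d (j - i)

/-- The triality Lie algebra condition. -/
def IsTri (q : QuadraticForm k C) (d : Fin 3 → Module.End k C) : Prop :=
  (∀ i : Fin 3, ∀ x y : C, bp q (d i x) y + bp q x (d i y) = 0) ∧
  (∀ x y : C, d 0 (pmul q x y) = pmul q (d 1 x) y + pmul q x (d 2 y))

/-- The endomorphism `D_{(d₀,d₁,d₂)}` of `J`. -/
def Dtri (d : Fin 3 → Module.End k C) : Module.End k (Jtype k C) where
  toFun x := (0, fun i => d i (x.2 i))
  map_add' x y := by
    refine Prod.ext ?_ ?_ <;> funext i <;> simp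
  map_smul' c x := by
    refine Prod.ext ?_ ?_ <;> funext i <;> simp

/-- The map `Φ : g(S₁,S) → der J`, `((d₀,d₁,d₂),(a₀,a₁,a₂)) ↦ D_{(d₀,d₁,d₂)} + ∑ D_i(a_i)`. -/
def Phi (q : QuadraticForm k C)
    (g : (Fin 3 → Module.End k C) × (Fin 3 → C)) : Jtype k C → Jtype k C :=
  fun y => Dtri g.1 y + ∑ i : Fin 3, Dfun q i (g.2 i) y

end

section Hurwitz

variable {k : Type*} [Field k] {C : Type*} [NonAssocRing C] [Module k C]
  (q : QuadraticForm k C)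

theorem bp_comm (x y : C) : bp q x y = bp q y x := QuadraticMap.polar_comm q x y

theorem bp_add_left (x y z : C) : bp q (x + y) z = bp q x z + bp q y z :=
  QuadraticMap.polar_add_left q x y z

theorem bp_add_right (x y z : C) : bp q x (y + z) = bp q x y + bp q x z :=
  QuadraticMap.polar_add_right q x y z

theorem bp_smul_left (c : k) (x y : C) : bp q (c • x) y = c * bp q x y :=
  QuadraticMap.polar_smul_left q c x y

theorem bp_smul_right (c : k) (x y : C) : bp q x (c • y) = c * bp q x y :=
  QuadraticMap.polar_smul_right q c x y

theorem bp_sub_left (x y z : C) : bp q (x - y) z = bp q x z - bp q y z :=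
  QuadraticMap.polar_sub_left q x y z

theorem bp_sub_right (x y z : C) : bp q x (y - z) = bp q x y - bp q x z :=
  QuadraticMap.polar_sub_right q x y z

theorem bp_zero_left (x : C) : bp q 0 x = 0 := QuadraticMap.polar_zero_left q x

theorem bp_zero_right (x : C) : bp q x 0 = 0 := QuadraticMap.polar_zero_right q x

theorem conj_add (x y : C) : conj q (x + y) = conj q x + conj q y := (conjL q).map_add x y

theorem conj_smul (c : k) (x : C) : conj q (c • x) = c • conj q x := (conjL q).map_smul c x

theorem conj_sub (x y : C) : conj q (x - y) = conj q x - conj q y := (conjL q).map_sub x y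

theorem conj_zero : conj q (0 : C) = 0 := (conjL q).map_zero

theorem pmul_add (x y z : C) : pmul q x (y + z) = pmul q x y + pmul q x z := by
  simp only [pmul, conj_add, mul_add]

theorem add_pmul (x y z : C) : pmul q (x + y) z = pmul q x z + pmul q y z := by
  simp only [pmul, conj_add, add_mul]

theorem pmul_sub (x y z : C) : pmul q x (y - z) = pmul q x y - pmul q x z := by
  simp only [pmul, conj_sub, mul_sub]

theorem sub_pmul (x y z : C) : pmul q (x - y) z = pmul q x z - pmul q y z := by
  simp only [pmul, conj_sub, sub_mul]

theorem pmul_smul [SMulCommClass k C C] (c : k) (x y : C) : pmul q x (c • y) = c • pmul q x y := by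
  simp only [pmul, conj_smul, mul_smul_comm]

theorem smul_pmul [IsScalarTower k C C] (c : k) (x y : C) : pmul q (c • x) y = c • pmul q x y := by
  simp only [pmul, conj_smul, smul_mul_assoc]

theorem pmul_zero (x : C) : pmul q x 0 = 0 := by
  simp only [pmul, conj_zero, mul_zero]

theorem zero_pmul (x : C) : pmul q 0 x = 0 := by
  simp only [pmul, conj_zero, zero_mul]

variable {q}

theorem eq_of_forall_bp (hreg : ∀ x : C, (∀ y, QuadraticMap.polar q x y = 0) → x = 0)
    {x y : C}
    (h : ∀ z, bp q x z = bp q y z) : x = y :=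
  sub_eq_zero.1 (hreg _ fun z => by
    have := bp_sub_left q x y z
    rwa [h, sub_self] at this)

theorem norm_one_eq_one_or_forall_eq_zero
    (hcomp : ∀ x y : C, q (x * y) = q x * q y) : q 1 = 1 ∨ ∀ x, q x = 0 := by
  by_cases h : ∀ x, q x = 0
  · exact Or.inr h
  · push Not at h
    obtain ⟨x, hx⟩ := h
    have := hcomp x 1
    rw [mul_one] at this
    exact Or.inl (mul_left_cancel₀ hx (by rw [← this, mul_one]))

/-- The linearized composition law. -/
theorem bp_mul_mul_add (hcomp : ∀ x y : C, q (x * y) = q x * q y) (x y z w : C) :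
    bp q (x * y) (z * w) + bp q (x * w) (z * y) = bp q x z * bp q y w := by
  have h1 := hcomp (x + z) (y + w)
  have h2 := hcomp (x + z) y
  have h3 := hcomp (x + z) w
  have h4 := hcomp x (y + w)
  have h5 := hcomp z (y + w)
  have e := QuadraticMap.map_add q
  simp only [mul_add, add_mul, e, QuadraticMap.polar_add_left, QuadraticMap.polar_add_right,
    hcomp] at h1 h2 h3 h4 h5
  simp only [bp]
  have c1 := QuadraticMap.polar_comm q (x * w) (z * y)
  linear_combination h1 - h2 - h3 - h4 - h5 + c1

theorem bp_one_one (hcomp : ∀ x y : C, q (x * y) = q x * q y) :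
    bp q (1 : C) 1 = 2 ∨ ∀ x y, bp q x y = 0 := by
  rcases norm_one_eq_one_or_forall_eq_zero hcomp with h | h
  · left
    rw [bp, QuadraticMap.polar_self, h]
    norm_num
  · right
    intro x y
    simp [bp, QuadraticMap.polar, h]

theorem bp_conj_conj (hcomp : ∀ x y : C, q (x * y) = q x * q y) (x y : C) :
    bp q (conj q x) (conj q y) = bp q x y := by
  rcases bp_one_one hcomp with h | h
  · simp only [conj, bp_sub_left, bp_sub_right, bp_smul_left, bp_smul_right, h, bp_comm q 1 y]
    ring
  · simp only [h]

theorem conj_conj (hcomp : ∀ x y : C, q (x * y) = q x * q y) (x : C) :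
    conj q (conj q x) = x := by
  rcases bp_one_one hcomp with h | h
  · simp only [conj, bp_sub_left, bp_smul_left, h]
    module
  · simp [conj, h]

theorem bp_mul_left [SMulCommClass k C C]
    (hcomp : ∀ x y : C, q (x * y) = q x * q y) (x y z : C) :
    bp q (x * y) z = bp q x (z * conj q y) := by
  have := bp_mul_mul_add hcomp x y z 1
  simp only [mul_one] at this
  simp only [conj, mul_sub, bp_sub_right, mul_smul_comm, mul_one, bp_smul_right]
  linear_combination this

theorem bp_mul_left' [IsScalarTower k C C]
    (hcomp : ∀ x y : C, q (x * y) = q x * q y) (x y z : C) :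
    bp q (x * y) z = bp q y (conj q x * z) := by
  have := bp_mul_mul_add hcomp x y 1 z
  simp only [one_mul] at this
  simp only [conj, sub_mul, bp_sub_right, smul_mul_assoc, one_mul, bp_smul_right]
  rw [bp_comm q y (x * z)]
  linear_combination this

variable [SMulCommClass k C C] [IsScalarTower k C C]

theorem conj_mul_rev (hcomp : ∀ x y : C, q (x * y) = q x * q y)
    (hreg : ∀ x : C, (∀ y, QuadraticMap.polar q x y = 0) → x = 0) (x y : C) :
    conj q (x * y) = conj q y * conj q x := by
  refine eq_of_forall_bp hreg fun z => ?_
  rw [← bp_conj_conj hcomp, conj_conj hcomp, bp_mul_left' hcomp, bp_comm, bp_mul_left hcomp,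
    conj_conj hcomp, bp_mul_left' hcomp, conj_conj hcomp]

theorem bp_pmul_left (hcomp : ∀ x y : C, q (x * y) = q x * q y)
    (hreg : ∀ x : C, (∀ y, QuadraticMap.polar q x y = 0) → x = 0) (x y z : C) :
    bp q (pmul q x y) z = bp q x (pmul q y z) := by
  rw [pmul, bp_mul_left hcomp, conj_conj hcomp, ← bp_conj_conj hcomp, conj_conj hcomp,
    conj_mul_rev hcomp hreg, pmul]

theorem pmul_pmul_add (hcomp : ∀ x y : C, q (x * y) = q x * q y)
    (hreg : ∀ x : C, (∀ y, QuadraticMap.polar q x y = 0) → x = 0) (x y z : C) :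
    pmul q (pmul q x y) z + pmul q (pmul q z y) x = bp q x z • y := by
  refine eq_of_forall_bp hreg fun w => ?_
  have := bp_mul_mul_add hcomp (conj q x) (conj q y) (conj q z) (conj q w)
  simp only [bp_conj_conj hcomp] at this
  rw [bp_add_left, bp_pmul_left hcomp hreg (pmul q x y),
    bp_pmul_left hcomp hreg (pmul q z y), bp_smul_left, ← this]
  simp only [pmul]
  rw [bp_comm q (conj q z * conj q y)]

theorem pmul_pmul_add' (hcomp : ∀ x y : C, q (x * y) = q x * q y)
    (hreg : ∀ x : C, (∀ y, QuadraticMap.polar q x y = 0) → x = 0) (x y z : C) :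
    pmul q x (pmul q y z) + pmul q z (pmul q y x) = bp q x z • y := by
  refine eq_of_forall_bp hreg fun w => ?_
  have := bp_mul_mul_add hcomp (conj q w) (conj q x) (conj q y) (conj q z)
  simp only [bp_conj_conj hcomp] at this
  rw [bp_add_left, bp_comm, ← bp_pmul_left hcomp hreg w, bp_comm q _ w,
    ← bp_pmul_left hcomp hreg w, bp_smul_left, mul_comm, bp_comm q y w, ← this]
  simp only [pmul]

end Hurwitz

section Jordan

theorem fin_three_add_one_add_one (i : Fin 3) : i + 1 + 1 = i + 2 := by fin_cases i <;> rfl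

theorem fin_three_add_one_add_two (i : Fin 3) : i + 1 + 2 = i := by fin_cases i <;> rfl

theorem fin_three_add_two_add_one (i : Fin 3) : i + 2 + 1 = i := by fin_cases i <;> rfl

theorem fin_three_add_two_add_two (i : Fin 3) : i + 2 + 2 = i + 1 := by fin_cases i <;> rfl

variable {k : Type*} [Field k] {C : Type*} [NonAssocRing C] [Module k C] {q : QuadraticForm k C}

theorem fin_three_add_one_ne_add_two (i : Fin 3) : i + 1 ≠ i + 2 := by fin_cases i <;> decide

theorem sum_fin_three {M : Type*} [AddCommMonoid M] (f : Fin 3 → M) (i : Fin 3) :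
    ∑ j, f j = f i + f (i + 1) + f (i + 2) := by
  fin_cases i <;> simp [Fin.sum_univ_three] <;> abel

theorem Dfun_fst_self (i : Fin 3) (a : C) (x : Jtype k C) :
    (Dfun q i a x).1 i = 0 := by
  simp [Dfun, brkt, Lmul, jmul, iot, ee, pmul_zero, zero_pmul, bp_zero_left,
    fin_three_add_two_add_one, fin_three_add_one_add_one, fin_three_add_one_add_two,
    fin_three_add_two_add_two, (fin_three_add_one_ne_add_two i).symm]

theorem Dfun_fst_add_two (hchar : (2 : k) ≠ 0) (i : Fin 3) (a : C) (x : Jtype k C) :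
    (Dfun q i a x).1 (i + 2) = 2 * bp q a (x.2 i) := by
  simp [Dfun, brkt, Lmul, jmul, iot, ee, pmul_zero, zero_pmul, bp_zero_left,
    fin_three_add_two_add_one, fin_three_add_one_add_one, fin_three_add_one_add_two,
    fin_three_add_two_add_two, (fin_three_add_one_ne_add_two i).symm, bp_smul_right, hchar]

theorem Dfun_snd_self (hchar : (2 : k) ≠ 0) (i : Fin 3) (a : C) (x : Jtype k C) :
    (Dfun q i a x).2 i = ((2 : k)⁻¹ * (x.1 (i + 1) - x.1 (i + 2))) • a := by
  simp [Dfun, brkt, Lmul, jmul, iot, ee, pmul_zero, zero_pmul, bp_zero_left,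
    fin_three_add_two_add_one, fin_three_add_one_add_one, fin_three_add_one_add_two,
    fin_three_add_two_add_two, (fin_three_add_one_ne_add_two i).symm]
  match_scalars
  field_simp
  ring

theorem Dfun_fst_add_one (hchar : (2 : k) ≠ 0) (i : Fin 3) (a : C) (x : Jtype k C) :
    (Dfun q i a x).1 (i + 1) = -(2 * bp q a (x.2 i)) := by
  simp [Dfun, brkt, Lmul, jmul, iot, ee, pmul_zero, zero_pmul, bp_zero_left,
    fin_three_add_two_add_one, fin_three_add_one_add_one, fin_three_add_one_add_two,
    fin_three_add_two_add_two, (fin_three_add_one_ne_add_two i).symm, bp_smul_right]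
  rw [mul_inv_cancel_left₀ hchar]
  ring

theorem jmul_comm (x y : Jtype k C) : jmul q x y = jmul q y x := by
  refine Prod.ext (funext fun i => ?_) (funext fun i => ?_)
  · simp only [jmul, bp_comm q (x.2 _)]
    ring
  · simp only [jmul]
    abel

theorem ee_jmul_fst (j l : Fin 3) (y : Jtype k C) :
    (jmul q (ee j) y).1 l = if l = j then y.1 l else 0 := by
  simp [jmul, ee, bp_zero_left, Pi.single_apply]

theorem ee_jmul_snd_self (i : Fin 3) (y : Jtype k C) : (jmul q (ee i) y).2 i = 0 := by
  simp [jmul, ee, pmul_zero, zero_pmul]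

theorem ee_add_one_jmul_snd (i : Fin 3) (y : Jtype k C) :
    (jmul q (ee (i + 1)) y).2 i = (2 : k)⁻¹ • y.2 i := by
  simp [jmul, ee, pmul_zero, zero_pmul, (fin_three_add_one_ne_add_two i).symm]

theorem ee_add_two_jmul_snd (i : Fin 3) (y : Jtype k C) :
    (jmul q (ee (i + 2)) y).2 i = (2 : k)⁻¹ • y.2 i := by
  simp [jmul, ee, pmul_zero, zero_pmul, fin_three_add_one_ne_add_two i]

theorem ee_jmul_ee_self (j : Fin 3) : jmul q (ee j) (ee j) = (ee j : Jtype k C) := by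
  refine Prod.ext (funext fun i => ?_) (funext fun i => ?_)
  · rw [ee_jmul_fst]
    by_cases h : i = j <;> simp [ee, h]
  · simp [jmul, ee, pmul_zero]

theorem ee_jmul_ee_of_ne {i j : Fin 3} (h : i ≠ j) :
    jmul q (ee i) (ee j) = (0 : Jtype k C) := by
  refine Prod.ext (funext fun l => ?_) (funext fun l => ?_)
  · rw [ee_jmul_fst]
    split_ifs with hl
    · simp [ee, hl, h]
    · rfl
  · simp [jmul, ee, pmul_zero]

theorem fin_three_eq_or (i j : Fin 3) : j = i ∨ j = i + 1 ∨ j = i + 2 := by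
  revert i j
  decide

theorem ee_jmul_iot_self (i : Fin 3) (b : C) :
    jmul q (ee i) (iot i b) = (0 : Jtype k C) := by
  refine Prod.ext (funext fun l => ?_) (funext fun l => ?_)
  · simp [ee_jmul_fst, iot]
  · rcases fin_three_eq_or i l with rfl | rfl | rfl <;> simp [jmul, ee, iot, zero_pmul, pmul_zero]

theorem ee_add_one_jmul_iot (i : Fin 3) (b : C) :
    jmul q (ee (i + 1)) (iot i b) = (2 : k)⁻¹ • (iot i b : Jtype k C) := by
  refine Prod.ext (funext fun l => ?_) (funext fun l => ?_)
  · simp [ee_jmul_fst, iot]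
  · rcases fin_three_eq_or i l with rfl | rfl | rfl <;>
      simp [jmul, ee, iot, zero_pmul, pmul_zero, (fin_three_add_one_ne_add_two _).symm]

theorem iot_jmul_iot_self (i : Fin 3) (a b : C) :
    jmul q (iot i a) (iot i b) = (2 * bp q a b) • (ee (i + 1) + ee (i + 2) : Jtype k C) := by
  refine Prod.ext (funext fun l => ?_) (funext fun l => ?_)
  · rcases fin_three_eq_or i l with rfl | rfl | rfl <;>
      simp [jmul, ee, iot, bp_zero_left, fin_three_add_one_add_one, fin_three_add_one_add_two,
        fin_three_add_two_add_one, fin_three_add_two_add_two, (fin_three_add_one_ne_add_two _),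
        (fin_three_add_one_ne_add_two _).symm]
  · rcases fin_three_eq_or i l with rfl | rfl | rfl <;>
      simp [jmul, ee, iot, zero_pmul, pmul_zero, fin_three_add_one_add_one,
        fin_three_add_one_add_two, fin_three_add_two_add_one, fin_three_add_two_add_two]

theorem iot_jmul_iot (i : Fin 3) (a b : C) :
    jmul q (iot (i + 1) a) (iot (i + 2) b) = (iot i (pmul q a b) : Jtype k C) := by
  refine Prod.ext (funext fun l => ?_) (funext fun l => ?_)
  · rcases fin_three_eq_or i l with rfl | rfl | rfl <;>
      simp [jmul, iot, bp_zero_left, bp_zero_right, fin_three_add_one_add_one,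
        fin_three_add_one_add_two, fin_three_add_two_add_one, fin_three_add_two_add_two,
        (fin_three_add_one_ne_add_two _), (fin_three_add_one_ne_add_two _).symm]
  · rcases fin_three_eq_or i l with rfl | rfl | rfl <;>
      simp [jmul, iot, zero_pmul, pmul_zero, fin_three_add_one_add_one,
        fin_three_add_one_add_two, fin_three_add_two_add_one, fin_three_add_two_add_two,
        (fin_three_add_one_ne_add_two _), (fin_three_add_one_ne_add_two _).symm]

theorem Jtype_eq_sum (x : Jtype k C) :
    x = ∑ j, x.1 j • (ee j : Jtype k C) + ∑ j, iot j (x.2 j) := by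
  refine Prod.ext (funext fun i => ?_) (funext fun i => ?_) <;>
    simp [ee, iot, Pi.single_apply, Prod.fst_sum, Prod.snd_sum]

theorem jmul_sub_left (x y z : Jtype k C) : jmul q (x - y) z = jmul q x z - jmul q y z := by
  refine Prod.ext (funext fun i => ?_) (funext fun i => ?_)
  · simp only [jmul, Prod.fst_sub, Prod.snd_sub, Pi.sub_apply, bp_sub_left]
    ring
  · simp only [jmul, Prod.fst_sub, Prod.snd_sub, Pi.sub_apply, sub_pmul, pmul_sub]
    module

theorem jmul_sub_right (x y z : Jtype k C) : jmul q x (y - z) = jmul q x y - jmul q x z := by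
  rw [jmul_comm, jmul_sub_left, jmul_comm y, jmul_comm z]

theorem Phi_fst (hchar : (2 : k) ≠ 0) (g : (Fin 3 → Module.End k C) × (Fin 3 → C))
    (x : Jtype k C) (j : Fin 3) :
    (Phi q g x).1 j =
      2 * bp q (g.2 (j + 1)) (x.2 (j + 1)) - 2 * bp q (g.2 (j + 2)) (x.2 (j + 2)) := by
  have h1 := Dfun_fst_add_two (q := q) hchar (j + 1) (g.2 (j + 1)) x
  have h2 := Dfun_fst_add_one (q := q) hchar (j + 2) (g.2 (j + 2)) x
  rw [fin_three_add_one_add_two] at h1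
  rw [fin_three_add_two_add_one] at h2
  simp only [Phi, Dtri, LinearMap.coe_mk, AddHom.coe_mk, Prod.fst_add, Pi.add_apply,
    sum_fin_three _ j, Dfun_fst_self, h1, h2, Pi.zero_apply]
  ring

/-- A derivation of `J` killing the diagonal idempotents comes from the triality Lie algebra. -/
theorem IsDerivJ.exists_Dtri (hchar : (2 : k) ≠ 0) {d : Module.End k (Jtype k C)}
    (hd : IsDerivJ q d) (he : ∀ j, d (ee j) = 0) :
    ∃ t : Fin 3 → Module.End k C, IsTri q t ∧ d = Dtri t := by
  let t : Fin 3 → Module.End k C := fun i => LinearMap.proj i ∘ₗ LinearMap.snd k _ _ ∘ₗ d ∘ₗ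
    LinearMap.inr k _ _ ∘ₗ LinearMap.single k (fun _ => C) i
  have z (x : Jtype k C) : jmul q 0 x = 0 := by
    refine Prod.ext (funext fun i => ?_) (funext fun i => ?_) <;>
      simp [jmul, bp_zero_left, pmul_zero, zero_pmul]
  have ht (i : Fin 3) (b : C) : d (iot i b) = iot i (t i b) := by
    have e := hd (ee i) (iot i b)
    have f := hd (ee (i + 1)) (iot i b)
    rw [he, z, zero_add] at e f
    rw [ee_jmul_iot_self, map_zero] at e
    rw [ee_add_one_jmul_iot, map_smul] at f
    refine Prod.ext (funext fun l => ?_) (funext fun l => ?_)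
    · have e' := congrFun (congrArg Prod.fst e) l
      have f' := congrFun (congrArg Prod.fst f) l
      simp only [ee_jmul_fst] at e' f'
      rcases fin_three_eq_or i l with rfl | rfl | rfl
      · simpa [iot] using e'.symm
      · simp only [Prod.smul_fst, Pi.smul_apply, smul_eq_mul, if_true] at f'
        field_simp at f'
        change (d (iot i b)).1 (i + 1) = 0
        linear_combination -f'
      · simpa [fin_three_add_one_ne_add_two, (fin_three_add_one_ne_add_two _).symm, hchar, iot]
          using f'
    · rcases fin_three_eq_or i l with rfl | rfl | rfl
      · simp [t, iot]
      · have := ee_add_two_jmul_snd (q := q) (i + 1) (d (iot i b))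
        rw [fin_three_add_one_add_two, ← e] at this
        simpa [iot, hchar] using this.symm
      · have := ee_add_one_jmul_snd (q := q) (i + 2) (d (iot i b))
        rw [fin_three_add_two_add_one, ← e] at this
        simpa [iot, hchar] using this.symm
  refine ⟨t, ⟨fun i x y => ?_, fun x y => ?_⟩, LinearMap.ext fun x => ?_⟩
  · have := congrFun (congrArg Prod.fst (hd (iot i x) (iot i y))) (i + 1)
    simp only [iot_jmul_iot_self, ht, map_smul, map_add, he] at this
    simpa [ee, ← mul_add, hchar, fin_three_add_one_ne_add_two] using this
  · have := congrFun (congrArg Prod.snd (hd (iot (0 + 1) x) (iot (0 + 2) y))) 0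
    simp only [iot_jmul_iot, ht] at this
    simpa [iot] using this
  · have := congrArg d (Jtype_eq_sum x)
    simp only [map_add, map_sum, map_smul, he, ht, smul_zero, Finset.sum_const_zero,
      zero_add] at this
    rw [this]
    refine Prod.ext (funext fun i => ?_) (funext fun i => ?_)
    · simp [Dtri, iot, Prod.fst_sum]
    · simp [Dtri, iot, Prod.snd_sum, Pi.single_apply]

variable [SMulCommClass k C C] [IsScalarTower k C C]

theorem Dfun_snd_add_one (hchar : (2 : k) ≠ 0) (i : Fin 3) (a : C) (x : Jtype k C) :
    (Dfun q i a x).2 (i + 1) = pmul q (x.2 (i + 2)) a := by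
  simp [Dfun, brkt, Lmul, jmul, iot, ee, pmul_zero, zero_pmul, bp_zero_left,
    fin_three_add_two_add_one, fin_three_add_one_add_one, fin_three_add_one_add_two,
    fin_three_add_two_add_two, (fin_three_add_one_ne_add_two i).symm, smul_pmul, pmul_smul]
  rw [smul_inv_smul₀ hchar]

theorem Dfun_snd_add_two (hchar : (2 : k) ≠ 0) (i : Fin 3) (a : C) (x : Jtype k C) :
    (Dfun q i a x).2 (i + 2) = -pmul q a (x.2 (i + 1)) := by
  simp [Dfun, brkt, Lmul, jmul, iot, ee, pmul_zero, zero_pmul, bp_zero_left,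
    fin_three_add_two_add_one, fin_three_add_one_add_one, fin_three_add_one_add_two,
    fin_three_add_two_add_two, (fin_three_add_one_ne_add_two i).symm, smul_pmul, pmul_smul]
  rw [smul_inv_smul₀ hchar]

theorem Phi_snd (hchar : (2 : k) ≠ 0) (g : (Fin 3 → Module.End k C) × (Fin 3 → C))
    (x : Jtype k C) (i : Fin 3) :
    (Phi q g x).2 i = g.1 i (x.2 i) + ((2 : k)⁻¹ * (x.1 (i + 1) - x.1 (i + 2))) • g.2 i
        - pmul q (g.2 (i + 1)) (x.2 (i + 2)) + pmul q (x.2 (i + 1)) (g.2 (i + 2)) := by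
  have h1 := Dfun_snd_add_two (q := q) hchar (i + 1) (g.2 (i + 1)) x
  have h2 := Dfun_snd_add_one (q := q) hchar (i + 2) (g.2 (i + 2)) x
  rw [fin_three_add_one_add_two, fin_three_add_one_add_one] at h1
  rw [fin_three_add_two_add_one, fin_three_add_two_add_two] at h2
  simp only [Phi, Dtri, LinearMap.coe_mk, AddHom.coe_mk, Prod.snd_add, Pi.add_apply,
    sum_fin_three _ i, Dfun_snd_self hchar, h1, h2]
  abel

theorem bp_pmul_rotate (hcomp : ∀ x y : C, q (x * y) = q x * q y)
    (hreg : ∀ x : C, (∀ y, QuadraticMap.polar q x y = 0) → x = 0) (x y z : C) :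
    bp q x (pmul q y z) = bp q y (pmul q z x) := by
  rw [bp_comm, bp_pmul_left hcomp hreg]

/-- The triality condition is invariant under cyclic permutations. -/
theorem IsTri.apply_pmul (hcomp : ∀ x y : C, q (x * y) = q x * q y)
    (hreg : ∀ x : C, (∀ y, QuadraticMap.polar q x y = 0) → x = 0)
    {d : Fin 3 → Module.End k C} (hd : IsTri q d) (i : Fin 3) (x y : C) :
    d i (pmul q x y) = pmul q (d (i + 1) x) y + pmul q x (d (i + 2) y) := by
  have rot : ∀ i : Fin 3,
      (∀ x y, d i (pmul q x y) = pmul q (d (i + 1) x) y + pmul q x (d (i + 2) y)) →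
      ∀ x y, d (i + 1) (pmul q x y) = pmul q (d (i + 2) x) y + pmul q x (d i y) := by
    intro i h x y
    refine eq_of_forall_bp hreg fun z => ?_
    have e1 := hd.1 (i + 1) (pmul q x y) z
    have e2 := congrArg (bp q · y) (h z x)
    have e3 := hd.1 i (pmul q z x) y
    simp only [bp_add_left, bp_pmul_left hcomp hreg] at e1 e2 e3 ⊢
    have e4 := bp_pmul_rotate hcomp hreg (d (i + 1) z) x y
    have e5 := bp_pmul_rotate hcomp hreg z (d (i + 2) x) y
    have e6 := bp_pmul_rotate hcomp hreg z x (d i y)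
    linear_combination e1 + e2 - e3 + e4 + e5 + e6
  have h0 : ∀ x y, d 0 (pmul q x y) = pmul q (d 1 x) y + pmul q x (d 2 y) := hd.2
  have h1 := rot 0 h0
  have h2 := rot 1 h1
  fin_cases i
  · exact h0 x y
  · exact h1 x y
  · exact h2 x y

theorem IsTri.isDerivJ_Phi (hchar : (2 : k) ≠ 0) (hcomp : ∀ x y : C, q (x * y) = q x * q y)
    (hreg : ∀ x : C, (∀ y, QuadraticMap.polar q x y = 0) → x = 0)
    {g : (Fin 3 → Module.End k C) × (Fin 3 → C)} (hg : IsTri q g.1) : IsDerivJ q (Phi q g) := by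
  intro x y
  obtain ⟨d, a⟩ := g
  obtain ⟨α, x⟩ := x
  obtain ⟨β, y⟩ := y
  have rot := bp_pmul_rotate hcomp hreg
  refine Prod.ext (funext fun i => ?_) (funext fun i => ?_)
  · simp only [jmul, Phi_fst hchar, Phi_snd hchar, Prod.fst_add, Pi.add_apply, bp_add_left,
      bp_add_right, bp_sub_left, bp_sub_right, bp_smul_left, bp_smul_right,
      fin_three_add_one_add_one, fin_three_add_one_add_two, fin_three_add_two_add_one,
      fin_three_add_two_add_two, bp_pmul_left hcomp hreg]
    have e1 := hg.1 (i + 1) (x (i + 1)) (y (i + 1))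
    have e2 := hg.1 (i + 2) (x (i + 2)) (y (i + 2))
    simp only at e1 e2
    simp only [← rot (x i), ← rot (a i), ← rot (y i), rot (x (i + 2)),
      rot (a (i + 2)), bp_comm q (x (i + 1)) (a (i + 1)), bp_comm q (x (i + 2)) (a (i + 2))]
    field_simp
    linear_combination -2 * e1 - 2 * e2
  · simp only [jmul, Phi_fst hchar, Phi_snd hchar, Prod.snd_add, Pi.add_apply, map_add, map_smul,
      pmul_add, add_pmul, pmul_sub, sub_pmul, pmul_smul, smul_pmul, hg.apply_pmul hcomp hreg,
      fin_three_add_one_add_one, fin_three_add_one_add_two, fin_three_add_two_add_one,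
      fin_three_add_two_add_two]
    have l1 := pmul_pmul_add hcomp hreg (x (i + 2)) (a i) (y (i + 2))
    have l2 := pmul_pmul_add hcomp hreg (a (i + 2)) (x i) (y (i + 2))
    have l3 := pmul_pmul_add hcomp hreg (a (i + 2)) (y i) (x (i + 2))
    have r1 := pmul_pmul_add' hcomp hreg (x (i + 1)) (a i) (y (i + 1))
    have r2 := pmul_pmul_add' hcomp hreg (a (i + 1)) (x i) (y (i + 1))
    have r3 := pmul_pmul_add' hcomp hreg (a (i + 1)) (y i) (x (i + 1))
    linear_combination (norm := (match_scalars <;> field_simp <;> ring)) l2 + l3 - l1 + r1 - r2 - r3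

theorem Phi_left_injective (hchar : (2 : k) ≠ 0)
    {g h : (Fin 3 → Module.End k C) × (Fin 3 → C)} (e : Phi q g = Phi q h) : g = h := by
  have ha (i : Fin 3) : g.2 i = h.2 i := by
    have := congrFun (congrArg Prod.snd (congrFun e (ee (i + 1)))) i
    simpa [Phi_snd hchar, ee, pmul_zero, zero_pmul, (fin_three_add_one_ne_add_two i).symm,
      hchar] using this
  refine Prod.ext (funext fun i => LinearMap.ext fun b => ?_) (funext ha)
  have := congrFun (congrArg Prod.snd (congrFun e (iot i b))) i
  simpa [Phi_snd hchar, iot, pmul_zero, zero_pmul] using this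

theorem Phi_add (hchar : (2 : k) ≠ 0) (g h : (Fin 3 → Module.End k C) × (Fin 3 → C)) :
    Phi q (g + h) = Phi q g + Phi q h := by
  funext x
  refine Prod.ext (funext fun i => ?_) (funext fun i => ?_)
  · simp only [Pi.add_apply, Prod.fst_add, Prod.snd_add, Phi_fst hchar, bp_add_left]
    ring
  · simp only [Pi.add_apply, Prod.fst_add, Prod.snd_add, Phi_snd hchar, pmul_add, add_pmul,
      LinearMap.add_apply]
    module

theorem Phi_smul (hchar : (2 : k) ≠ 0) (c : k) (g : (Fin 3 → Module.End k C) × (Fin 3 → C)) :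
    Phi q (c • g) = c • Phi q g := by
  funext x
  refine Prod.ext (funext fun i => ?_) (funext fun i => ?_)
  · simp only [Pi.smul_apply, Prod.smul_fst, Prod.smul_snd, Phi_fst hchar, bp_smul_left,
      smul_eq_mul]
    ring
  · simp only [Pi.smul_apply, Prod.smul_fst, Prod.smul_snd, Phi_snd hchar, pmul_smul, smul_pmul,
      LinearMap.smul_apply]
    module

/-- A derivation of `J` agrees on the diagonal idempotents with some `∑ D_i(a_i)`. -/
theorem IsDerivJ.exists_Phi_ee (hchar : (2 : k) ≠ 0) {d : Module.End k (Jtype k C)}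
    (hd : IsDerivJ q d) : ∃ a : Fin 3 → C, ∀ j, d (ee j) = Phi q (0, a) (ee j) := by
  have e (j : Fin 3) := hd (ee j) (ee j)
  simp only [ee_jmul_ee_self, jmul_comm (d (ee _)) (ee _)] at e
  have f (i : Fin 3) := congrFun (congrArg Prod.snd
    (hd (ee (i + 1)) (ee (i + 2)))) i
  simp only [ee_jmul_ee_of_ne (fin_three_add_one_ne_add_two _), jmul_comm (d (ee _)) (ee _),
    map_zero, Prod.snd_zero, Prod.snd_add, Pi.add_apply, Pi.zero_apply, ee_add_one_jmul_snd,
    ee_add_two_jmul_snd] at f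
  refine ⟨fun i => (2 : k) • (d (ee (i + 1))).2 i, fun j => ?_⟩
  refine Prod.ext (funext fun l => ?_) (funext fun i => ?_)
  · have := congrFun (congrArg Prod.fst (e j)) l
    simp only [Prod.fst_add, Pi.add_apply, ee_jmul_fst] at this
    rw [Phi_fst hchar]
    split_ifs at this <;> simpa [ee, bp_zero_right] using this
  · rw [Phi_snd hchar]
    rcases fin_three_eq_or i j with rfl | rfl | rfl
    · have := congrFun (congrArg Prod.snd (e j)) j
      simp only [Prod.snd_add, Pi.add_apply, ee_jmul_snd_self, add_zero] at this
      rw [this]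
      simp [ee, pmul_zero, zero_pmul]
    · simp [ee, pmul_zero, zero_pmul, (fin_three_add_one_ne_add_two i).symm, smul_smul, hchar]
    · have := f i
      rw [← smul_add, eq_comm, smul_eq_zero_iff_right (inv_ne_zero hchar)] at this
      simpa [ee, pmul_zero, zero_pmul, fin_three_add_one_ne_add_two i, smul_smul,
        hchar, eq_neg_iff_add_eq_zero, add_comm] using this

/-- The map `Φ(g)` as a linear endomorphism of `J`. -/
def PhiEnd (hchar : (2 : k) ≠ 0) (q : QuadraticForm k C)
    (g : (Fin 3 → Module.End k C) × (Fin 3 → C)) : Module.End k (Jtype k C) where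
  toFun := Phi q g
  map_add' x y := by
    refine Prod.ext (funext fun i => ?_) (funext fun i => ?_)
    · simp only [Pi.add_apply, Prod.fst_add, Prod.snd_add, Phi_fst hchar, bp_add_right]
      ring
    · simp only [Pi.add_apply, Prod.fst_add, Prod.snd_add, Phi_snd hchar, pmul_add, add_pmul,
        map_add]
      module
  map_smul' c x := by
    refine Prod.ext (funext fun i => ?_) (funext fun i => ?_)
    · simp only [Pi.smul_apply, Prod.smul_fst, Prod.smul_snd, Phi_fst hchar, bp_smul_right,
        smul_eq_mul, RingHom.id_apply]
      ring
    · simp only [Pi.smul_apply, Prod.smul_fst, Prod.smul_snd, Phi_snd hchar, pmul_smul, smul_pmul,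
        map_smul, smul_eq_mul, RingHom.id_apply]
      module

/-- Every derivation of `J` is of the form `Φ(g)`. -/
theorem IsDerivJ.exists_Phi (hchar : (2 : k) ≠ 0) (hcomp : ∀ x y : C, q (x * y) = q x * q y)
    (hreg : ∀ x : C, (∀ y, QuadraticMap.polar q x y = 0) → x = 0)
    {d : Module.End k (Jtype k C)} (hd : IsDerivJ q d) :
    ∃ g : (Fin 3 → Module.End k C) × (Fin 3 → C), IsTri q g.1 ∧ Phi q g = d := by
  obtain ⟨a, ha⟩ := hd.exists_Phi_ee hchar
  have h0 : IsTri q (0 : Fin 3 → Module.End k C) :=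
    ⟨fun i x y => by simp [bp_zero_left, bp_zero_right], fun x y => by
      simp [pmul_zero, zero_pmul]⟩
  have hD : IsDerivJ q (Phi q ((0 : Fin 3 → Module.End k C), a)) :=
    IsTri.isDerivJ_Phi hchar hcomp hreg h0
  have hsub : IsDerivJ q ⇑(d - PhiEnd hchar q (0, a)) := fun x y => by
    change d _ - Phi q (0, a) _ = jmul q (d x - Phi q (0, a) x) y + jmul q x (d y - Phi q (0, a) y)
    rw [hd, hD, jmul_sub_left, jmul_sub_right]
    abel
  obtain ⟨t, ht, e⟩ := hsub.exists_Dtri hchar fun j => sub_eq_zero.2 (ha j)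
  refine ⟨(t, a), ht, funext fun x => ?_⟩
  have hx : d x - Phi q (0, a) x = Dtri t x := LinearMap.congr_fun e x
  rw [← sub_add_cancel (d x) (Phi q (0, a) x), hx]
  have : Dtri (0 : Fin 3 → Module.End k C) x = 0 := rfl
  simp only [Phi, this, zero_add]

theorem br_apply
    {br : ((Fin 3 → Module.End k C) × (Fin 3 → C)) →ₗ[k]
      ((Fin 3 → Module.End k C) × (Fin 3 → C)) →ₗ[k]
      ((Fin 3 → Module.End k C) × (Fin 3 → C))}
    (hanti : ∀ g h, br g h = - br h g)
    (hbr1 : ∀ d d' : Fin 3 → Module.End k C,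
      br (d, 0) (d', 0) = ((fun i => ⁅d i, d' i⁆), 0))
    (hbr2 : ∀ (d : Fin 3 → Module.End k C) (i : Fin 3) (a : C),
      br (d, 0) (0, Pi.single i a) = (0, Pi.single i (d i a)))
    (hbr3 : ∀ (i : Fin 3) (a b : C),
      br (0, Pi.single i a) (0, Pi.single (i+1) b) = (0, Pi.single (i+2) (pmul q a b)))
    (hbr4 : ∀ (i : Fin 3) (a b : C),
      br (0, Pi.single i a) (0, Pi.single i b) = ((2:k) • tshift i (tq q a b), 0))
    (g h : (Fin 3 → Module.End k C) × (Fin 3 → C)) :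
    br g h = (fun i => ⁅g.1 i, h.1 i⁆ + (2 : k) • (tq q (g.2 i) (h.2 i) 0 +
        tq q (g.2 (i + 1)) (h.2 (i + 1)) 2 + tq q (g.2 (i + 2)) (h.2 (i + 2)) 1),
      fun i => g.1 i (h.2 i) - h.1 i (g.2 i) + pmul q (g.2 (i + 1)) (h.2 (i + 2)) -
        pmul q (h.2 (i + 1)) (g.2 (i + 2))) := by
  obtain ⟨d, a⟩ := g
  obtain ⟨d', a'⟩ := h
  have dec (d : Fin 3 → Module.End k C) (a : Fin 3 → C) :
      (d, a) = (d, 0) + ∑ i, ((0 : Fin 3 → Module.End k C), Pi.single i (a i)) := by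
    refine Prod.ext ?_ (funext fun i => ?_) <;> simp [Prod.fst_sum, Prod.snd_sum, Pi.single_apply]
  have h5 (i : Fin 3) (a b : C) :
      br (0, Pi.single i a) (0, Pi.single (i + 2) b) = -(0, Pi.single (i + 1) (pmul q b a)) := by
    have := hbr3 (i + 2) b a
    rw [fin_three_add_two_add_one, fin_three_add_two_add_two] at this
    rw [hanti, this]
  have h6 (d : Fin 3 → Module.End k C) (i : Fin 3) (a : C) :
      br (0, Pi.single i a) (d, 0) = -(0, Pi.single i (d i a)) := by
    rw [hanti, hbr2]
  have h7 : br (0, a) (0, a') = ∑ i : Fin 3, (((2 : k) • tshift i (tq q (a i) (a' i)), 0) +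
      (0, Pi.single (i + 2) (pmul q (a i) (a' (i + 1)))) -
      (0, Pi.single (i + 1) (pmul q (a' (i + 2)) (a i)))) := by
    rw [dec 0 a, dec 0 a']
    simp only [Prod.mk_zero_zero, zero_add, map_sum, LinearMap.sum_apply]
    rw [Finset.sum_comm]
    refine Finset.sum_congr rfl fun i _ => ?_
    rw [sum_fin_three _ i, hbr4, hbr3, h5]
    abel
  have s1 (i : Fin 3) : i - (i + 1) = 2 := by fin_cases i <;> rfl
  have s2 (i : Fin 3) : i - (i + 2) = 1 := by fin_cases i <;> rfl
  have h8 : br (d, a) (d', a') = br (d, 0) (d', 0) + br (d, 0) (0, a') + br (0, a) (d', 0) +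
      br (0, a) (0, a') := by
    rw [← zero_add a, ← add_zero d, ← zero_add a', ← add_zero d', ← Prod.mk_add_mk,
      ← Prod.mk_add_mk]
    simp only [map_add, LinearMap.add_apply, zero_add, add_zero]
    abel
  have h9 : br (d, 0) (0, a') = (0, fun i => d i (a' i)) := by
    rw [dec 0 a']
    simp only [Prod.mk_zero_zero, zero_add, map_sum, hbr2]
    refine Prod.ext ?_ (funext fun i => ?_) <;> simp [Prod.fst_sum, Prod.snd_sum, Pi.single_apply]
  have h10 : br (0, a) (d', 0) = -(0, fun i => d' i (a i)) := by
    rw [dec 0 a]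
    simp only [Prod.mk_zero_zero, zero_add, map_sum, LinearMap.sum_apply, h6]
    refine Prod.ext ?_ (funext fun i => ?_) <;> simp [Prod.fst_sum, Prod.snd_sum, Pi.single_apply]
  rw [h8, h9, h10, h7, hbr1]
  refine Prod.ext (funext fun i => ?_) (funext fun i => ?_)
  · simp only [sum_fin_three _ i]
    simp [tshift, s1, s2]
  · simp only [sum_fin_three _ i]
    simp [fin_three_add_one_add_one,
        fin_three_add_one_add_two, fin_three_add_two_add_one, fin_three_add_two_add_two]
    abel

theorem Phi_brkt (hchar : (2 : k) ≠ 0) (hcomp : ∀ x y : C, q (x * y) = q x * q y)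
    (hreg : ∀ x : C, (∀ y, QuadraticMap.polar q x y = 0) → x = 0)
    {g h b : (Fin 3 → Module.End k C) × (Fin 3 → C)} (hg : IsTri q g.1) (hh : IsTri q h.1)
    (hb : b = (fun i => ⁅g.1 i, h.1 i⁆ + (2 : k) • (tq q (g.2 i) (h.2 i) 0 +
        tq q (g.2 (i + 1)) (h.2 (i + 1)) 2 + tq q (g.2 (i + 2)) (h.2 (i + 2)) 1),
      fun i => g.1 i (h.2 i) - h.1 i (g.2 i) + pmul q (g.2 (i + 1)) (h.2 (i + 2)) -
        pmul q (h.2 (i + 1)) (g.2 (i + 2)))) :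
    Phi q b = brkt (Phi q g) (Phi q h) := by
  subst hb
  obtain ⟨d, a⟩ := g
  obtain ⟨d', a'⟩ := h
  funext ⟨α, x⟩
  have rot := bp_pmul_rotate hcomp hreg
  simp only at hg hh
  refine Prod.ext (funext fun i => ?_) (funext fun i => ?_)
  · simp only [brkt, Phi_fst hchar, Phi_snd hchar, Prod.fst_sub, Pi.sub_apply, bp_add_left,
      bp_add_right, bp_sub_left, bp_sub_right, bp_smul_right,
      fin_three_add_one_add_one, fin_three_add_one_add_two, fin_three_add_two_add_one,
      fin_three_add_two_add_two, bp_pmul_left hcomp hreg]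
    have e1 := hg.1 (i + 1) (a' (i + 1)) (x (i + 1))
    have e2 := hg.1 (i + 2) (a' (i + 2)) (x (i + 2))
    have e3 := hh.1 (i + 1) (a (i + 1)) (x (i + 1))
    have e4 := hh.1 (i + 2) (a (i + 2)) (x (i + 2))
    simp only [← rot (x i), ← rot (a i), ← rot (a' i), rot (a' (i + 2)),
      rot (a (i + 2)), bp_comm q (a' (i + 1)) (a (i + 1)), bp_comm q (a' (i + 2)) (a (i + 2))]
    field_simp
    linear_combination 2 * e1 - 2 * e2 - 2 * e3 + 2 * e4
  · simp only [brkt, Phi_fst hchar, Phi_snd hchar, Prod.snd_sub, Pi.sub_apply, map_add, map_sub,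
      map_smul, pmul_add, add_pmul, pmul_sub, sub_pmul, pmul_smul, smul_pmul,
      hg.apply_pmul hcomp hreg, hh.apply_pmul hcomp hreg,
      fin_three_add_one_add_one, fin_three_add_one_add_two, fin_three_add_two_add_one,
      fin_three_add_two_add_two]
    have l1 := pmul_pmul_add hcomp hreg (a (i + 2)) (a' i) (x (i + 2))
    have l2 := pmul_pmul_add hcomp hreg (a' (i + 2)) (a i) (x (i + 2))
    have l3 := pmul_pmul_add hcomp hreg (a' (i + 2)) (x i) (a (i + 2))
    have r1 := pmul_pmul_add' hcomp hreg (x (i + 1)) (a i) (a' (i + 1))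
    have r2 := pmul_pmul_add' hcomp hreg (x (i + 1)) (a' i) (a (i + 1))
    have r3 := pmul_pmul_add' hcomp hreg (a (i + 1)) (x i) (a' (i + 1))
    have t0 (u v w : C) : tq q u v 0 w = bp q u w • v - bp q v w • u := rfl
    have t1 (u v w : C) :
      tq q u v 1 w = ((2 : k)⁻¹ * bp q u v) • w - pmul q (pmul q v w) u := rfl
    have t2 (u v w : C) :
      tq q u v 2 w = ((2 : k)⁻¹ * bp q u v) • w - pmul q u (pmul q w v) := rfl
    simp only [LinearMap.add_apply, LinearMap.smul_apply, t0, t1, t2, Ring.lie_def,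
      LinearMap.sub_apply, Module.End.mul_apply]
    rw [bp_comm q (a' (i + 2)) (a (i + 2))] at l3
    rw [bp_comm q (x (i + 1)) (a' (i + 1))] at r1
    rw [bp_comm q (x (i + 1)) (a (i + 1))] at r2
    linear_combination (norm := (match_scalars <;> field_simp <;> ring))
      -l1 + l2 - l3 + r1 - r2 - r3

end Jordan

/-- The map `Φ : g(S₁,S) → der J`, with `Φ((d₀,d₁,d₂)) = D_{(d₀,d₁,d₂)}`
and `Φ(ι_i(a)) = D_i(a)`, is an isomorphism of Lie algebras: it is linear, sends
`g(S₁,S)` (= pairs `(d, a)` with `d ∈ tri(S)`) bijectively onto `der J`, and transforms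
the bracket of `g(S₁,S)` (given on generators by the formulas of the context) into the
commutator of endomorphisms of `J`. -/
theorem stmt_13 {k : Type*} [Field k] {C : Type*} [NonAssocRing C] [Module k C]
    [SMulCommClass k C C] [IsScalarTower k C C]
    (hchar : (2 : k) ≠ 0)
    (q : QuadraticForm k C)
    (hcomp : ∀ x y : C, q (x * y) = q x * q y)
    (hreg : ∀ x : C, (∀ y, QuadraticMap.polar q x y = 0) → x = 0)
    -- the bracket of g(S₁,S), determined by anticommutativity and its values on generators:
    (br : ((Fin 3 → Module.End k C) × (Fin 3 → C)) →ₗ[k]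
      ((Fin 3 → Module.End k C) × (Fin 3 → C)) →ₗ[k]
      ((Fin 3 → Module.End k C) × (Fin 3 → C)))
    (hanti : ∀ g h, br g h = - br h g)
    (hbr1 : ∀ d d' : Fin 3 → Module.End k C,
      br (d, 0) (d', 0) = ((fun i => ⁅d i, d' i⁆), 0))
    (hbr2 : ∀ (d : Fin 3 → Module.End k C) (i : Fin 3) (a : C),
      br (d, 0) (0, Pi.single i a) = (0, Pi.single i (d i a)))
    (hbr3 : ∀ (i : Fin 3) (a b : C),
      br (0, Pi.single i a) (0, Pi.single (i+1) b) = (0, Pi.single (i+2) (pmul q a b)))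
    (hbr4 : ∀ (i : Fin 3) (a b : C),
      br (0, Pi.single i a) (0, Pi.single i b) = ((2:k) • tshift i (tq q a b), 0)) :
    -- Φ is linear:
    (∀ g h : (Fin 3 → Module.End k C) × (Fin 3 → C), Phi q (g + h) = Phi q g + Phi q h) ∧
    (∀ (c : k) (g : (Fin 3 → Module.End k C) × (Fin 3 → C)), Phi q (c • g) = c • Phi q g) ∧
    -- Φ maps g(S₁,S) into der J:
    (∀ g : (Fin 3 → Module.End k C) × (Fin 3 → C), IsTri q g.1 → IsDerivJ q (Phi q g)) ∧
    -- Φ is injective on g(S₁,S):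
    (∀ g h : (Fin 3 → Module.End k C) × (Fin 3 → C), IsTri q g.1 → IsTri q h.1 →
      Phi q g = Phi q h → g = h) ∧
    -- Φ is onto der J:
    (∀ d : Module.End k (Jtype k C), IsDerivJ q ⇑d →
      ∃ g : (Fin 3 → Module.End k C) × (Fin 3 → C), IsTri q g.1 ∧ Phi q g = ⇑d) ∧
    -- Φ is a homomorphism of Lie algebras:
    (∀ g h : (Fin 3 → Module.End k C) × (Fin 3 → C), IsTri q g.1 → IsTri q h.1 →
      Phi q (br g h) = brkt (Phi q g) (Phi q h)) := by
  refine ⟨Phi_add hchar, Phi_smul hchar, fun g hg => hg.isDerivJ_Phi hchar hcomp hreg,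
    fun g h _ _ e => Phi_left_injective hchar e, fun d hd => hd.exists_Phi hchar hcomp hreg,
    fun g h hg hh => Phi_brkt hchar hcomp hreg hg hh (br_apply hanti hbr1 hbr2 hbr3 hbr4 g h)⟩
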